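/- Let F = x y z³ + (x³ + x² y + 2 x y² + 2 y³) z² + (2 x² y² + 2 x y³ + y⁴) z + 2 x⁵ + x³ y², a homogeneous polynomial of degree 5 with coefficients in F_3. The number of points of the projective plane ℙ²(F_3) at which F vanishes is exactly 11. (The unique singular point (0:0:1) of V(F) is a split node, so the normalization of V(F) is a genus-five trigonal curve over F_3 with exactly 12 F_3-rational points, the maximal possible number for a genus-five trigonal curve over F_3.) -/

import Mathlib

/-- The quintic form as a function of three coordinates. -/
def quinticVal (x y z : ZMod 3) : ZMod 3 :=
  x * y * z ^ 3 + (x ^ 3 + x ^ 2 * y + 2 * x * y ^ 2 + 2 * y ^ 3) * z ^ 2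
    + (2 * x ^ 2 * y ^ 2 + 2 * x * y ^ 3 + y ^ 4) * z + 2 * x ^ 5 + x ^ 3 * y ^ 2

/-- The first nonzero coordinate. -/
def leadCoord (x y z : ZMod 3) : ZMod 3 :=
  if x = 0 then (if y = 0 then z else y) else x

/-- Normalized zeros: the first nonzero coordinate is one. -/
abbrev NormZero : Type :=
  {t : ZMod 3 × ZMod 3 × ZMod 3 // leadCoord t.1 t.2.1 t.2.2 = 1 ∧ quinticVal t.1 t.2.1 t.2.2 = 0}

theorem lead_sq : ∀ x y z : ZMod 3, ¬ (x = 0 ∧ y = 0 ∧ z = 0) →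
    leadCoord x y z * leadCoord x y z = 1 := by decide

theorem lead_smul : ∀ a x y z : ZMod 3,
    leadCoord (a * x) (a * y) (a * z) = a * leadCoord x y z := by decide

theorem quintic_smul (a x y z : ZMod 3) :
    quinticVal (a * x) (a * y) (a * z) = a ^ 5 * quinticVal x y z := by
  unfold quinticVal; ring

theorem unit_sq : ∀ a : ZMod 3, a ≠ 0 → a * a = 1 := by decide

theorem card_normZero : Fintype.card NormZero = 11 := by decide

theorem not_all_zero (v : Fin 3 → ZMod 3) (hv : v ≠ 0) : ¬ (v 0 = 0 ∧ v 1 = 0 ∧ v 2 = 0) := by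
  rintro ⟨h0, h1, h2⟩
  apply hv
  funext i
  fin_cases i <;> assumption

/-- The normalized coordinates of a zero. -/
noncomputable def normMap (P : {P : Projectivization (ZMod 3) (Fin 3 → ZMod 3) //
    quinticVal (P.rep 0) (P.rep 1) (P.rep 2) = 0}) : NormZero :=
  let c := leadCoord (P.1.rep 0) (P.1.rep 1) (P.1.rep 2)
  ⟨(c * P.1.rep 0, c * P.1.rep 1, c * P.1.rep 2), by
    constructor
    · rw [lead_smul]
      exact lead_sq _ _ _ (not_all_zero _ P.1.rep_nonzero)
    · rw [quintic_smul, P.2, mul_zero]⟩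

theorem normMap_injective : Function.Injective normMap := by
  rintro ⟨P, hP⟩ ⟨Q, hQ⟩ h
  have h' := congrArg Subtype.val h
  simp only [normMap, Prod.mk.injEq] at h'
  obtain ⟨h0, h1, h2⟩ := h'
  have hp := lead_sq _ _ _ (not_all_zero _ P.rep_nonzero)
  apply Subtype.ext
  change P = Q
  rw [← P.mk_rep, ← Q.mk_rep, Projectivization.mk_eq_mk_iff']
  generalize leadCoord (P.rep 0) (P.rep 1) (P.rep 2) = c at *
  generalize leadCoord (Q.rep 0) (Q.rep 1) (Q.rep 2) = d at *
  refine ⟨c * d, ?_⟩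
  funext i
  have key : ∀ p q : ZMod 3, c * p = d * q → (c * d) * q = p := by
    intro p q e
    linear_combination (-c) * e + p * hp
  fin_cases i
  · exact key _ _ h0
  · exact key _ _ h1
  · exact key _ _ h2

theorem normMap_surjective : Function.Surjective normMap := by
  rintro ⟨⟨x, y, z⟩, hl, hq⟩
  simp only at hl hq
  have hv : (![x, y, z] : Fin 3 → ZMod 3) ≠ 0 := by
    intro h
    have h0 : x = 0 := congrFun h 0
    have h1 : y = 0 := congrFun h 1
    have h2 : z = 0 := congrFun h 2
    subst h0 h1 h2
    revert hl
    decide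
  obtain ⟨a, ha⟩ := Projectivization.exists_smul_eq_mk_rep (ZMod 3) _ hv
  have e0 : (Projectivization.mk (ZMod 3) _ hv).rep 0 = a * x := (congrFun ha 0).symm
  have e1 : (Projectivization.mk (ZMod 3) _ hv).rep 1 = a * y := (congrFun ha 1).symm
  have e2 : (Projectivization.mk (ZMod 3) _ hv).rep 2 = a * z := (congrFun ha 2).symm
  have hs := unit_sq a a.ne_zero
  refine ⟨⟨Projectivization.mk (ZMod 3) _ hv, ?_⟩, ?_⟩
  · rw [e0, e1, e2, quintic_smul, hq, mul_zero]
  · apply Subtype.ext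
    simp only [normMap, e0, e1, e2, lead_smul, hl, mul_one, ← mul_assoc, hs, one_mul]

/-- The plane quintic
`F₁ = xyz³ + (x³ + x²y + 2xy² + 2y³)z² + (2x²y² + 2xy³ + y⁴)z + 2x⁵ + x³y²`
(split node case) has exactly `11` zeros in `ℙ²(F₃)`, so its normalization is a
genus-five trigonal curve over `F₃` with `12` `F₃`-rational points. -/
theorem trigonal_example_split_node_F3_count :
    Nat.card {P : Projectivization (ZMod 3) (Fin 3 → ZMod 3) //
      P.rep 0 * P.rep 1 * P.rep 2 ^ 3
      + (P.rep 0 ^ 3 + P.rep 0 ^ 2 * P.rep 1 + 2 * P.rep 0 * P.rep 1 ^ 2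
          + 2 * P.rep 1 ^ 3) * P.rep 2 ^ 2
      + (2 * P.rep 0 ^ 2 * P.rep 1 ^ 2 + 2 * P.rep 0 * P.rep 1 ^ 3 + P.rep 1 ^ 4) * P.rep 2
      + 2 * P.rep 0 ^ 5 + P.rep 0 ^ 3 * P.rep 1 ^ 2 = 0} = 11 := by
  rw [← card_normZero, ← Nat.card_eq_fintype_card]
  exact Nat.card_congr (Equiv.ofBijective normMap ⟨normMap_injective, normMap_surjective⟩)
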